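/- The map (-Δ)^{-1} is a bounded linear operator from Y to X: there is a constant C > 0 (independent of x, μ, L in the admissible range) such that for every pair (f,g) ∈ Y, the pair (u,v) = (∫_Ω G(z,·)f(z)dz, ∫_Ω G(z,·)g(z)dz) belongs to X and ‖(u,v)‖_* ≤ C‖(f,g)‖_{**}. -/

import Mathlib

open Real MeasureTheory Filter Topology
open scoped Classical

noncomputable section

namespace PeriodicCriticalSystem

/-- Euclidean space `ℝ^N`. -/
abbrev Euc (N : ℕ) : Type := EuclideanSpace ℝ (Fin N)

/-- The `i`-th standard coordinate vector `e_i`. -/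
def e (N : ℕ) (i : Fin N) : Euc N := EuclideanSpace.single i 1

/-- The strip `Ω = {y : |y_i| ≤ L/2, i = 1,…,k}`. -/
def strip (N k : ℕ) (L : ℝ) : Set (Euc N) :=
  {y : Euc N | ∀ i : Fin N, (i : ℕ) < k → |y i| ≤ L / 2}

/-- The `i`-th partial derivative. -/
def pd {N : ℕ} (i : Fin N) (u : Euc N → ℝ) (y : Euc N) : ℝ := fderiv ℝ u y (e N i)

/-- The Laplacian `Δu = Σ_i ∂²u/∂y_i²`. -/
def lap {N : ℕ} (u : Euc N → ℝ) (y : Euc N) : ℝ :=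
  ∑ i : Fin N, iteratedDeriv 2 (fun t : ℝ => u (y + t • e N i)) 0

/-- The norm `|y''|` of the last `N - k` coordinates. -/
def tailNorm {N : ℕ} (k : ℕ) (y : Euc N) : ℝ :=
  Real.sqrt (∑ i : Fin N, if k ≤ (i : ℕ) then (y i) ^ 2 else 0)

/-- The periodic boundary conditions on the strip, together with decay as `|y''| → ∞`. -/
structure PeriodicBC (N k : ℕ) (L : ℝ) (u : Euc N → ℝ) : Prop where
  per : ∀ i : Fin N, (i : ℕ) < k → ∀ y : Euc N, y i = -(L / 2) → u (y + L • e N i) = u y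
  per_deriv : ∀ i : Fin N, (i : ℕ) < k → ∀ y : Euc N, y i = -(L / 2) →
    pd i u (y + L • e N i) = pd i u y
  decay : ∀ ε : ℝ, 0 < ε → ∃ R : ℝ, ∀ y ∈ strip N k L, R ≤ tailNorm k y → |u y| < ε

/-- The critical Sobolev exponent `2* = 2N/(N-2)`. -/
def tS (N : ℕ) : ℝ := 2 * (N : ℝ) / ((N : ℝ) - 2)

/-- Conditions (A₁) and (A₂) on a coefficient function `K`. -/
structure CondA (N k : ℕ) (K : Euc N → ℝ) (a β : Fin N → ℝ) (βm βM σ : ℝ) : Prop where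
  periodic : ∀ i : Fin N, (i : ℕ) < k → ∀ y : Euc N, K (y + e N i) = K y
  bounded : ∃ M : ℝ, ∀ y : Euc N, |K y| ≤ M
  a_ne : ∀ i : Fin N, a i ≠ 0
  β_gt : ∀ i : Fin N, (N : ℝ) - 2 < β i
  β_lt : ∀ i : Fin N, β i < (N : ℝ)
  βm_le : ∀ i : Fin N, βm ≤ β i
  βm_mem : ∃ i : Fin N, β i = βm
  le_βM : ∀ i : Fin N, β i ≤ βM
  βM_mem : ∃ i : Fin N, β i = βM
  βM_le : βM ≤ βm * (1 + 1 / ((N : ℝ) - 2))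
  σ_pos : 0 < σ
  expansion : ∃ δ C : ℝ, 0 < δ ∧ 0 < C ∧ ∀ x : Euc N, ‖x‖ < δ →
    |K x - 1 - ∑ i : Fin N, a i * |x i| ^ (β i)| ≤ C * ‖x‖ ^ (βM + σ)
  neg_sum : (∑ i ∈ Finset.univ.filter (fun i => β i = βm), a i) < 0

/-- The standard bubble `W_{x,μ}`. -/
def Wb (N : ℕ) (x : Euc N) (μ : ℝ) (y : Euc N) : ℝ :=
  ((N : ℝ) * ((N : ℝ) - 2)) ^ (((N : ℝ) - 2) / 4) * μ ^ (((N : ℝ) - 2) / 2) /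
    (1 + μ ^ 2 * ‖y - x‖ ^ 2) ^ (((N : ℝ) - 2) / 2)

/-- The synchronized bubble `U_{x,μ} = s W_{x,μ}`. -/
def Ub (N : ℕ) (s : ℝ) (x : Euc N) (μ : ℝ) (y : Euc N) : ℝ := s * Wb N x μ y

/-- The synchronized bubble `V_{x,μ} = κ s W_{x,μ}`. -/
def Vb (N : ℕ) (s κ : ℝ) (x : Euc N) (μ : ℝ) (y : Euc N) : ℝ := κ * s * Wb N x μ y

/-- The algebraic relations defining the synchronization constants `s` and `κ`. -/
def SyncConst (N : ℕ) (s κ : ℝ) : Prop :=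
  0 < s ∧ 0 < κ ∧ s ^ (tS N - 2) = 2 / (2 + κ ^ (tS N / 2)) ∧
    2 + κ ^ (tS N / 2) - κ ^ (tS N / 2 - 1) - 2 * κ ^ (tS N - 1) = 0

/-- The lattice `Q_k` of integer points in the first `k` coordinates. -/
def Qlat (N k : ℕ) : Set (Euc N) :=
  {y : Euc N | (∀ i : Fin N, ∃ m : ℤ, y i = (m : ℝ)) ∧ ∀ i : Fin N, k ≤ (i : ℕ) → y i = 0}

/-- `P` enumerates the lattice `Q_k` with `P 0 = 0`. -/
def LatticeEnum (N k : ℕ) (P : ℕ → Euc N) : Prop :=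
  Function.Injective P ∧ Set.range P = Qlat N k ∧ P 0 = 0

/-- The area `ω_{N-1}` of the unit sphere `S^{N-1}`. -/
def sphereArea (N : ℕ) : ℝ := (N : ℝ) * (volume (Metric.ball (0 : Euc N) 1)).toReal

/-- The fundamental solution `Γ(y,z)` of `-Δ`. -/
def Γfun (N : ℕ) (y z : Euc N) : ℝ :=
  1 / (((N : ℝ) - 2) * sphereArea N * ‖y - z‖ ^ ((N : ℝ) - 2))

/-- The Green's function of `-Δ` on the strip with periodic boundary conditions. -/
def Green (N : ℕ) (L : ℝ) (P : ℕ → Euc N) (y z : Euc N) : ℝ :=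
  ∑' j : ℕ, Γfun N (y + L • P j) z

/-- The projected bubble `PU_{x,μ}`. -/
def PU (N k : ℕ) (L : ℝ) (P : ℕ → Euc N) (s κ : ℝ) (x : Euc N) (μ : ℝ) (y : Euc N) : ℝ :=
  ∫ z in strip N k L, Green N L P y z *
    (Ub N s x μ z ^ (tS N - 1) +
      (1 / 2) * Ub N s x μ z ^ (tS N / 2 - 1) * Vb N s κ x μ z ^ (tS N / 2))

/-- The projected bubble `PV_{x,μ}`. -/
def PV (N k : ℕ) (L : ℝ) (P : ℕ → Euc N) (s κ : ℝ) (x : Euc N) (μ : ℝ) (y : Euc N) : ℝ :=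
  ∫ z in strip N k L, Green N L P y z *
    (Vb N s κ x μ z ^ (tS N - 1) +
      (1 / 2) * Vb N s κ x μ z ^ (tS N / 2 - 1) * Ub N s x μ z ^ (tS N / 2))

/-- The translated centers `x_j = x - L P_j`. -/
def xc {N : ℕ} (L : ℝ) (P : ℕ → Euc N) (x : Euc N) (j : ℕ) : Euc N := x - L • P j

/-- The extra weight `σ(y)`. -/
def σw {N : ℕ} (x : Euc N) (μ τ : ℝ) (y : Euc N) : ℝ :=
  min 1 (((1 + μ * ‖y - x‖) / μ) ^ (τ - 1))

/-- The weight defining the `*` norm. -/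
def wStar (N : ℕ) (L : ℝ) (P : ℕ → Euc N) (x : Euc N) (μ τ : ℝ) (y : Euc N) : ℝ :=
  σw x μ τ y *
    ∑' j : ℕ, μ ^ (((N : ℝ) - 2) / 2) / (1 + μ * ‖y - xc L P x j‖) ^ (((N : ℝ) - 2) / 2 + τ)

/-- The weight defining the `**` norm. -/
def wStarStar (N : ℕ) (L : ℝ) (P : ℕ → Euc N) (x : Euc N) (μ τ : ℝ) (y : Euc N) : ℝ :=
  σw x μ τ y *
    ∑' j : ℕ, μ ^ (((N : ℝ) + 2) / 2) / (1 + μ * ‖y - xc L P x j‖) ^ (((N : ℝ) + 2) / 2 + τ)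

/-- The `*` norm. -/
def normStar (N k : ℕ) (L : ℝ) (P : ℕ → Euc N) (x : Euc N) (μ τ : ℝ) (u : Euc N → ℝ) : ℝ :=
  sSup ((fun y => |u y| / wStar N L P x μ τ y) '' strip N k L)

/-- The `**` norm. -/
def normStarStar (N k : ℕ) (L : ℝ) (P : ℕ → Euc N) (x : Euc N) (μ τ : ℝ) (f : Euc N → ℝ) : ℝ :=
  sSup ((fun y => |f y| / wStarStar N L P x μ τ y) '' strip N k L)

/-- Finiteness of the `*` norm. -/
def FiniteStar (N k : ℕ) (L : ℝ) (P : ℕ → Euc N) (x : Euc N) (μ τ : ℝ) (u : Euc N → ℝ) : Prop :=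
  BddAbove ((fun y => |u y| / wStar N L P x μ τ y) '' strip N k L)

/-- Finiteness of the `**` norm. -/
def FiniteStarStar (N k : ℕ) (L : ℝ) (P : ℕ → Euc N) (x : Euc N) (μ τ : ℝ)
    (f : Euc N → ℝ) : Prop :=
  BddAbove ((fun y => |f y| / wStarStar N L P x μ τ y) '' strip N k L)

/-- Membership of a pair in the space `X`. -/
def MemX (N k : ℕ) (L : ℝ) (P : ℕ → Euc N) (x : Euc N) (μ τ : ℝ) (u v : Euc N → ℝ) : Prop :=
  PeriodicBC N k L u ∧ PeriodicBC N k L v ∧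
    FiniteStar N k L P x μ τ u ∧ FiniteStar N k L P x μ τ v

/-- Membership of a pair in the space `Y`. -/
def MemY (N k : ℕ) (L : ℝ) (P : ℕ → Euc N) (x : Euc N) (μ τ : ℝ) (f g : Euc N → ℝ) : Prop :=
  FiniteStarStar N k L P x μ τ f ∧ FiniteStarStar N k L P x μ τ g

/-- The operator `(-Δ)^{-1}` given by the Green's function. -/
def invLap (N k : ℕ) (L : ℝ) (P : ℕ → Euc N) (f : Euc N → ℝ) (y : Euc N) : ℝ :=
  ∫ z in strip N k L, Green N L P z y * f z

/-- `Y_h`: derivatives of `U_{x,μ}` in `x_h` (`h < N`) and in `μ` (`h = N+1`). -/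
def Yd (N : ℕ) (s : ℝ) (x : Euc N) (μ : ℝ) (h : Fin (N + 1)) (y : Euc N) : ℝ :=
  if hh : (h : ℕ) < N then fderiv ℝ (fun x' => Ub N s x' μ y) x (e N ⟨(h : ℕ), hh⟩)
  else deriv (fun μ' => Ub N s x μ' y) μ

/-- `Z_h`: derivatives of `V_{x,μ}`. -/
def Zd (N : ℕ) (s κ : ℝ) (x : Euc N) (μ : ℝ) (h : Fin (N + 1)) (y : Euc N) : ℝ :=
  if hh : (h : ℕ) < N then fderiv ℝ (fun x' => Vb N s κ x' μ y) x (e N ⟨(h : ℕ), hh⟩)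
  else deriv (fun μ' => Vb N s κ x μ' y) μ

/-- `∂_h PU_{x,μ}`. -/
def dPU (N k : ℕ) (L : ℝ) (P : ℕ → Euc N) (s κ : ℝ) (x : Euc N) (μ : ℝ) (h : Fin (N + 1))
    (y : Euc N) : ℝ :=
  if hh : (h : ℕ) < N then fderiv ℝ (fun x' => PU N k L P s κ x' μ y) x (e N ⟨(h : ℕ), hh⟩)
  else deriv (fun μ' => PU N k L P s κ x μ' y) μ

/-- `∂_h PV_{x,μ}`. -/
def dPV (N k : ℕ) (L : ℝ) (P : ℕ → Euc N) (s κ : ℝ) (x : Euc N) (μ : ℝ) (h : Fin (N + 1))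
    (y : Euc N) : ℝ :=
  if hh : (h : ℕ) < N then fderiv ℝ (fun x' => PV N k L P s κ x' μ y) x (e N ⟨(h : ℕ), hh⟩)
  else deriv (fun μ' => PV N k L P s κ x μ' y) μ

/-- `α(h) = 1` for `h = 1,…,N` and `α(N+1) = -1`. -/
def αe (N : ℕ) (h : Fin (N + 1)) : ℝ := if (h : ℕ) < N then 1 else -1

/-- Membership of a pair in the space `E`. -/
def MemE (N k : ℕ) (L : ℝ) (P : ℕ → Euc N) (s κ : ℝ) (x : Euc N) (μ τ : ℝ)
    (u v : Euc N → ℝ) : Prop :=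
  MemX N k L P x μ τ u v ∧
    (∀ h : Fin (N + 1),
      (∫ y in strip N k L, u y * Ub N s x μ y ^ (tS N - 2) * Yd N s x μ h y) = 0) ∧
    (∀ h : Fin (N + 1),
      (∫ y in strip N k L, v y * Vb N s κ x μ y ^ (tS N - 2) * Zd N s κ x μ h y) = 0)

/-- Membership of a pair in the space `F`. -/
def MemF (N k : ℕ) (L : ℝ) (P : ℕ → Euc N) (s κ : ℝ) (x : Euc N) (μ : ℝ)
    (f g : Euc N → ℝ) : Prop :=
  (∀ h : Fin (N + 1), (∫ y in strip N k L, f y * dPU N k L P s κ x μ h y) = 0) ∧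
  (∀ h : Fin (N + 1), (∫ y in strip N k L, g y * dPV N k L P s κ x μ h y) = 0)

/-- The admissible range of the parameters `(x, μ)` relative to `L`. -/
def Admissible (N : ℕ) (θ C0 β : ℝ) (L : ℝ) (x : Euc N) (μ : ℝ) : Prop :=
  1 ≤ μ ∧ 1 ≤ L ∧ ‖x‖ ≤ μ ^ (-(1 + θ)) ∧
    μ * L ^ (-(((N : ℝ) - 2) / (β - ((N : ℝ) - 2)))) ∈ Set.Icc (C0 / 2) (2 * C0)

/-- First component of the linearized operator. -/
def lin1 (N k : ℕ) (L : ℝ) (P : ℕ → Euc N) (s κ : ℝ) (K1 : Euc N → ℝ) (x : Euc N) (μ : ℝ)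
    (ω1 ω2 : Euc N → ℝ) (y : Euc N) : ℝ :=
  K1 y * PU N k L P s κ x μ y ^ (tS N - 2) * ω1 y -
    (1 / ((N : ℝ) + 2)) * PU N k L P s κ x μ y ^ ((4 - (N : ℝ)) / ((N : ℝ) - 2)) *
      PV N k L P s κ x μ y ^ ((N : ℝ) / ((N : ℝ) - 2)) * ω1 y -
    ((N : ℝ) / (2 * ((N : ℝ) + 2))) * PU N k L P s κ x μ y ^ (2 / ((N : ℝ) - 2)) *
      PV N k L P s κ x μ y ^ (2 / ((N : ℝ) - 2)) * ω2 y

/-- Second component of the linearized operator. -/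
def lin2 (N k : ℕ) (L : ℝ) (P : ℕ → Euc N) (s κ : ℝ) (K2 : Euc N → ℝ) (x : Euc N) (μ : ℝ)
    (ω1 ω2 : Euc N → ℝ) (y : Euc N) : ℝ :=
  K2 y * PV N k L P s κ x μ y ^ (tS N - 2) * ω2 y -
    (1 / ((N : ℝ) + 2)) * PV N k L P s κ x μ y ^ ((4 - (N : ℝ)) / ((N : ℝ) - 2)) *
      PU N k L P s κ x μ y ^ ((N : ℝ) / ((N : ℝ) - 2)) * ω2 y -
    ((N : ℝ) / (2 * ((N : ℝ) + 2))) * PV N k L P s κ x μ y ^ (2 / ((N : ℝ) - 2)) *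
      PU N k L P s κ x μ y ^ (2 / ((N : ℝ) - 2)) * ω1 y

/-- First component `ℓ₁` of the error term. -/
def ell1 (N k : ℕ) (L : ℝ) (P : ℕ → Euc N) (s κ : ℝ) (K1 : Euc N → ℝ) (x : Euc N) (μ : ℝ)
    (y : Euc N) : ℝ :=
  K1 y * PU N k L P s κ x μ y ^ (tS N - 1) - Ub N s x μ y ^ (tS N - 1) -
    (1 / 2) * (Ub N s x μ y ^ (tS N / 2 - 1) * Vb N s κ x μ y ^ (tS N / 2) -
      PU N k L P s κ x μ y ^ (tS N / 2 - 1) * PV N k L P s κ x μ y ^ (tS N / 2))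

/-- Second component `ℓ₂` of the error term. -/
def ell2 (N k : ℕ) (L : ℝ) (P : ℕ → Euc N) (s κ : ℝ) (K2 : Euc N → ℝ) (x : Euc N) (μ : ℝ)
    (y : Euc N) : ℝ :=
  K2 y * PV N k L P s κ x μ y ^ (tS N - 1) - Vb N s κ x μ y ^ (tS N - 1) -
    (1 / 2) * (Vb N s κ x μ y ^ (tS N / 2 - 1) * Ub N s x μ y ^ (tS N / 2) -
      PV N k L P s κ x μ y ^ (tS N / 2 - 1) * PU N k L P s κ x μ y ^ (tS N / 2))

/-- First component `N₁` of the higher order term. -/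
def Nl1 (N k : ℕ) (L : ℝ) (P : ℕ → Euc N) (s κ : ℝ) (K1 : Euc N → ℝ) (x : Euc N) (μ : ℝ)
    (ω1 ω2 : Euc N → ℝ) (y : Euc N) : ℝ :=
  K1 y * ((max (PU N k L P s κ x μ y + ω1 y) 0) ^ (tS N - 1) -
      PU N k L P s κ x μ y ^ (tS N - 1) -
      (tS N - 1) * PU N k L P s κ x μ y ^ (tS N - 2) * ω1 y) +
    (1 / 2) * ((PU N k L P s κ x μ y + ω1 y) ^ (2 / ((N : ℝ) - 2)) *
        (PV N k L P s κ x μ y + ω2 y) ^ ((N : ℝ) / ((N : ℝ) - 2)) -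
      PU N k L P s κ x μ y ^ (2 / ((N : ℝ) - 2)) *
        PV N k L P s κ x μ y ^ ((N : ℝ) / ((N : ℝ) - 2))) -
    (1 / ((N : ℝ) - 2)) * PU N k L P s κ x μ y ^ ((4 - (N : ℝ)) / ((N : ℝ) - 2)) *
      PV N k L P s κ x μ y ^ ((N : ℝ) / ((N : ℝ) - 2)) * ω1 y -
    ((N : ℝ) / (2 * ((N : ℝ) - 2))) * PU N k L P s κ x μ y ^ (2 / ((N : ℝ) - 2)) *
      PV N k L P s κ x μ y ^ (2 / ((N : ℝ) - 2)) * ω2 y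

/-- Second component `N₂` of the higher order term. -/
def Nl2 (N k : ℕ) (L : ℝ) (P : ℕ → Euc N) (s κ : ℝ) (K2 : Euc N → ℝ) (x : Euc N) (μ : ℝ)
    (ω1 ω2 : Euc N → ℝ) (y : Euc N) : ℝ :=
  K2 y * ((max (PV N k L P s κ x μ y + ω2 y) 0) ^ (tS N - 1) -
      PV N k L P s κ x μ y ^ (tS N - 1) -
      (tS N - 1) * PV N k L P s κ x μ y ^ (tS N - 2) * ω2 y) +
    (1 / 2) * ((PV N k L P s κ x μ y + ω2 y) ^ (2 / ((N : ℝ) - 2)) *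
        (PU N k L P s κ x μ y + ω1 y) ^ ((N : ℝ) / ((N : ℝ) - 2)) -
      PV N k L P s κ x μ y ^ (2 / ((N : ℝ) - 2)) *
        PU N k L P s κ x μ y ^ ((N : ℝ) / ((N : ℝ) - 2))) -
    (1 / ((N : ℝ) - 2)) * PV N k L P s κ x μ y ^ ((4 - (N : ℝ)) / ((N : ℝ) - 2)) *
      PU N k L P s κ x μ y ^ ((N : ℝ) / ((N : ℝ) - 2)) * ω2 y -
    ((N : ℝ) / (2 * ((N : ℝ) - 2))) * PV N k L P s κ x μ y ^ (2 / ((N : ℝ) - 2)) *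
      PU N k L P s κ x μ y ^ (2 / ((N : ℝ) - 2)) * ω1 y


/-! ### Newtonian potentials of power weights -/

lemma lintegral_radial {N : ℕ} (hN : 0 < N) (f : ℝ → ℝ) (hf : ∀ t, 0 ≤ t → 0 ≤ f t)
    (hi : IntegrableOn (fun r : ℝ => r ^ (N - 1) * f r) (Set.Ioi 0)) :
    ∫⁻ z : Euc N, ENNReal.ofReal (f ‖z‖) =
      ENNReal.ofReal (N * (volume.real (Metric.ball (0 : Euc N) 1) *
        ∫ r in Set.Ioi (0 : ℝ), r ^ (N - 1) * f r)) := by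
  have : Nonempty (Fin N) := ⟨⟨0, hN⟩⟩
  have : Nontrivial (Euc N) := inferInstance
  have h1 : Integrable (fun z : Euc N => f ‖z‖) := by
    rw [integrable_fun_norm_addHaar]
    simpa using hi
  rw [← ofReal_integral_eq_lintegral_ofReal h1
    (Filter.Eventually.of_forall fun z => hf _ (norm_nonneg z)), integral_fun_norm_addHaar]
  simp

/-- The truncated power `t ^ (-q)` on `t ≤ R`. -/
def powIn (q R : ℝ) : ℝ → ℝ := (Set.Iic R).indicator fun t => t ^ (-q)

/-- The truncated power `t ^ (-q)` on `R < t`. -/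
def powOut (q R : ℝ) : ℝ → ℝ := (Set.Ioi R).indicator fun t => t ^ (-q)

lemma measurable_powIn (q R : ℝ) : Measurable (powIn q R) :=
  Measurable.indicator (by fun_prop) measurableSet_Iic

lemma measurable_powOut (q R : ℝ) : Measurable (powOut q R) :=
  Measurable.indicator (by fun_prop) measurableSet_Ioi

lemma powIn_nonneg (q R : ℝ) {t : ℝ} (ht : 0 ≤ t) : 0 ≤ powIn q R t := by
  unfold powIn Set.indicator
  split_ifs <;> positivity

lemma powOut_nonneg (q R : ℝ) {t : ℝ} (ht : 0 ≤ t) : 0 ≤ powOut q R t := by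
  unfold powOut Set.indicator
  split_ifs <;> positivity

lemma pow_pred_mul_rpow {N : ℕ} (hN : 0 < N) (q : ℝ) {r : ℝ} (hr : 0 < r) :
    r ^ (N - 1) * r ^ (-q) = r ^ ((N : ℝ) - 1 - q) := by
  rw [← Real.rpow_natCast, ← Real.rpow_add hr, Nat.cast_sub hN]
  congr 1
  push_cast
  ring

lemma lintegral_powIn {N : ℕ} (hN : 0 < N) {q : ℝ} (hq : q < N) :
    ∃ C : ℝ, 0 ≤ C ∧ ∀ R : ℝ, 0 < R →
      ∫⁻ z : Euc N, ENNReal.ofReal (powIn q R ‖z‖) ≤ ENNReal.ofReal (C * R ^ ((N : ℝ) - q)) := by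
  have hq' : 0 < (N : ℝ) - q := by linarith
  refine ⟨N * (volume.real (Metric.ball (0 : Euc N) 1) * (1 / ((N : ℝ) - q))), by positivity,
    fun R hR => ?_⟩
  have heq : Set.EqOn (fun r : ℝ => r ^ (N - 1) * powIn q R r)
      ((Set.Iic R).indicator fun r : ℝ => r ^ ((N : ℝ) - 1 - q)) (Set.Ioi 0) := by
    intro r hr
    by_cases h : r ≤ R
    · simp [powIn, h, pow_pred_mul_rpow hN q hr]
    · simp [powIn, h]
  have hint : IntervalIntegrable (fun r : ℝ => r ^ ((N : ℝ) - 1 - q)) volume 0 R :=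
    intervalIntegral.intervalIntegrable_rpow' (by linarith)
  have hset : Set.Ioi (0 : ℝ) ∩ Set.Iic R = Set.Ioc 0 R := rfl
  have hi : IntegrableOn (fun r : ℝ => r ^ (N - 1) * powIn q R r) (Set.Ioi 0) := by
    rw [integrableOn_congr_fun heq measurableSet_Ioi, integrableOn_indicator_iff measurableSet_Iic,
      Set.inter_comm, hset]
    exact (intervalIntegrable_iff_integrableOn_Ioc_of_le hR.le).1 hint
  rw [lintegral_radial hN _ (fun t ht => powIn_nonneg q R ht) hi,
    setIntegral_congr_fun measurableSet_Ioi heq, setIntegral_indicator measurableSet_Iic, hset,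
    ← intervalIntegral.integral_of_le hR.le, integral_rpow (Or.inl (by linarith))]
  apply ENNReal.ofReal_le_ofReal
  rw [show (N : ℝ) - 1 - q + 1 = N - q by ring, Real.zero_rpow hq'.ne']
  apply le_of_eq
  ring

lemma lintegral_powOut {N : ℕ} (hN : 0 < N) {q : ℝ} (hq : N < q) :
    ∃ C : ℝ, 0 ≤ C ∧ ∀ R : ℝ, 0 < R →
      ∫⁻ z : Euc N, ENNReal.ofReal (powOut q R ‖z‖) ≤ ENNReal.ofReal (C * R ^ ((N : ℝ) - q)) := by
  have hq' : 0 < q - N := by linarith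
  refine ⟨N * (volume.real (Metric.ball (0 : Euc N) 1) * (1 / (q - N))), by positivity,
    fun R hR => ?_⟩
  have heq : Set.EqOn (fun r : ℝ => r ^ (N - 1) * powOut q R r)
      ((Set.Ioi R).indicator fun r : ℝ => r ^ ((N : ℝ) - 1 - q)) (Set.Ioi 0) := by
    intro r hr
    by_cases h : R < r
    · simp [powOut, h, pow_pred_mul_rpow hN q hr]
    · simp [powOut, h]
  have hset : Set.Ioi (0 : ℝ) ∩ Set.Ioi R = Set.Ioi R :=
    Set.inter_eq_right.2 (Set.Ioi_subset_Ioi hR.le)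
  have hi : IntegrableOn (fun r : ℝ => r ^ (N - 1) * powOut q R r) (Set.Ioi 0) := by
    rw [integrableOn_congr_fun heq measurableSet_Ioi, integrableOn_indicator_iff measurableSet_Ioi,
      Set.inter_comm, hset]
    exact integrableOn_Ioi_rpow_of_lt (by linarith) hR
  rw [lintegral_radial hN _ (fun t ht => powOut_nonneg q R ht) hi,
    setIntegral_congr_fun measurableSet_Ioi heq, setIntegral_indicator measurableSet_Ioi, hset,
    integral_Ioi_rpow_of_lt (by linarith) hR]
  apply ENNReal.ofReal_le_ofReal
  rw [show (N : ℝ) - 1 - q + 1 = -(q - N) by ring, show (N : ℝ) - q = -(q - N) by ring,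
    neg_div_neg_eq]
  apply le_of_eq
  ring

lemma newton_kernel_le {N : ℕ} {α p R : ℝ} (hα : 0 < α) (hp : 0 < p) {ε : ℝ} (hε : 0 < ε)
    {y z : Euc N} (hR : R = (ε + ‖y‖) / 2) (hz : z ≠ 0) :
    ‖z - y‖ ^ (-α) * (ε + ‖z‖) ^ (-p) ≤
      R ^ (-p) * powIn α R ‖z - y‖ + R ^ (-α) * powIn p (4 * R) ‖z‖ +
        2 ^ α * powOut (α + p) (4 * R) ‖z‖ := by
  have hR0 : 0 < R := by rw [hR]; positivity
  have hz0 : 0 < ‖z‖ := norm_pos_iff.2 hz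
  have n1 := powIn_nonneg α R (norm_nonneg (z - y))
  have n2 := powIn_nonneg p (4 * R) (norm_nonneg z)
  have n3 := powOut_nonneg (α + p) (4 * R) (norm_nonneg z)
  by_cases h1 : ‖z - y‖ ≤ R
  · have e1 : powIn α R ‖z - y‖ = ‖z - y‖ ^ (-α) := by simp [powIn, h1]
    have h2 : ‖y‖ ≤ ‖z‖ + ‖z - y‖ := by
      rw [norm_sub_rev]; simpa using norm_add_le z (y - z)
    have h3 : (ε + ‖z‖) ^ (-p) ≤ R ^ (-p) :=
      Real.rpow_le_rpow_of_nonpos hR0 (by linarith) (by linarith)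
    have h4 : ‖z - y‖ ^ (-α) * (ε + ‖z‖) ^ (-p) ≤ R ^ (-p) * powIn α R ‖z - y‖ := by
      rw [e1, mul_comm]
      gcongr
    have : 0 ≤ R ^ (-α) * powIn p (4 * R) ‖z‖ := by positivity
    have : 0 ≤ 2 ^ α * powOut (α + p) (4 * R) ‖z‖ := by positivity
    linarith
  · push Not at h1
    have a1 : 0 ≤ R ^ (-p) * powIn α R ‖z - y‖ := by positivity
    have hpz : (ε + ‖z‖) ^ (-p) ≤ ‖z‖ ^ (-p) :=
      Real.rpow_le_rpow_of_nonpos hz0 (by linarith) (by linarith)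
    by_cases h2 : ‖z‖ ≤ 4 * R
    · have e2 : powIn p (4 * R) ‖z‖ = ‖z‖ ^ (-p) := by simp [powIn, h2]
      have h3 : ‖z - y‖ ^ (-α) ≤ R ^ (-α) :=
        Real.rpow_le_rpow_of_nonpos hR0 h1.le (by linarith)
      have h4 : ‖z - y‖ ^ (-α) * (ε + ‖z‖) ^ (-p) ≤ R ^ (-α) * powIn p (4 * R) ‖z‖ := by
        rw [e2]
        gcongr
      have : 0 ≤ 2 ^ α * powOut (α + p) (4 * R) ‖z‖ := by positivity
      linarith
    · push Not at h2
      have e3 : powOut (α + p) (4 * R) ‖z‖ = ‖z‖ ^ (-α) * ‖z‖ ^ (-p) := by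
        rw [← Real.rpow_add hz0]
        simp [powOut, h2, add_comm]
      have h5 : ‖z‖ ≤ ‖y‖ + ‖z - y‖ := by simpa using norm_add_le y (z - y)
      have h3 : ‖z - y‖ ^ (-α) ≤ (‖z‖ / 2) ^ (-α) :=
        Real.rpow_le_rpow_of_nonpos (by positivity) (by linarith) (by linarith)
      have h6 : (‖z‖ / 2) ^ (-α) = 2 ^ α * ‖z‖ ^ (-α) := by
        rw [Real.div_rpow hz0.le (by norm_num), Real.rpow_neg (by norm_num : (0 : ℝ) ≤ 2)]
        field_simp
      have h4 : ‖z - y‖ ^ (-α) * (ε + ‖z‖) ^ (-p) ≤ 2 ^ α * powOut (α + p) (4 * R) ‖z‖ := by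
        rw [e3, ← mul_assoc, ← h6]
        gcongr
      have : 0 ≤ R ^ (-α) * powIn p (4 * R) ‖z‖ := by positivity
      linarith

/-- The Newtonian potential of `(ε + |z|) ^ (-p)`, `2 < p < N`, is `O((ε + |y|) ^ (2 - p))`
uniformly in `ε`. -/
lemma newton_potential_le {N : ℕ} (hN : 3 ≤ N) {p : ℝ} (hp2 : 2 < p) (hpN : p < N) :
    ∃ C : ℝ, 0 ≤ C ∧ ∀ ε : ℝ, 0 < ε → ∀ y c : Euc N,
      ∫⁻ z : Euc N, ENNReal.ofReal (‖z - y‖ ^ (-((N : ℝ) - 2)) * (ε + ‖z - c‖) ^ (-p)) ≤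
        ENNReal.ofReal (C * (ε + ‖y - c‖) ^ (2 - p)) := by
  have hN0 : 0 < N := by omega
  have hNr : (3 : ℝ) ≤ N := by exact_mod_cast hN
  have : Nonempty (Fin N) := ⟨⟨0, hN0⟩⟩
  have : Nontrivial (Euc N) := inferInstance
  set α : ℝ := (N : ℝ) - 2 with hα
  have hα0 : 0 < α := by linarith
  obtain ⟨C1, hC1, H1⟩ := lintegral_powIn hN0 (q := α) (by linarith)
  obtain ⟨C2, hC2, H2⟩ := lintegral_powIn hN0 (q := p) hpN
  obtain ⟨C3, hC3, H3⟩ := lintegral_powOut hN0 (q := α + p) (by linarith)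
  set C := C1 + C2 * 4 ^ ((N : ℝ) - p) + 2 ^ α * (C3 * 4 ^ (2 - p)) with hC
  refine ⟨C * 2 ^ (p - 2), by positivity, fun ε hε y c => ?_⟩
  wlog hc : c = 0 generalizing y c
  · have := this (y - c) 0 rfl
    rw [← lintegral_sub_right_eq_self _ c] at this
    simpa using this
  subst hc
  simp only [sub_zero]
  set R := (ε + ‖y‖) / 2 with hR
  have hR0 : 0 < R := by positivity
  have hae : ∀ᵐ z : Euc N, z ≠ 0 := compl_mem_ae_iff.2 (measure_singleton 0)
  have m1 : Measurable fun z : Euc N => ENNReal.ofReal (powIn α R ‖z - y‖) :=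
    ((measurable_powIn α R).comp (by fun_prop : Measurable fun z : Euc N => ‖z - y‖)).ennreal_ofReal
  have m2 : Measurable fun z : Euc N => ENNReal.ofReal (powIn p (4 * R) ‖z‖) :=
    ((measurable_powIn p (4 * R)).comp measurable_norm).ennreal_ofReal
  have m3 : Measurable fun z : Euc N => ENNReal.ofReal (powOut (α + p) (4 * R) ‖z‖) :=
    ((measurable_powOut (α + p) (4 * R)).comp measurable_norm).ennreal_ofReal
  calc ∫⁻ z : Euc N, ENNReal.ofReal (‖z - y‖ ^ (-α) * (ε + ‖z‖) ^ (-p))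
      ≤ ∫⁻ z : Euc N, (ENNReal.ofReal (R ^ (-p)) * ENNReal.ofReal (powIn α R ‖z - y‖) +
          ENNReal.ofReal (R ^ (-α)) * ENNReal.ofReal (powIn p (4 * R) ‖z‖) +
          ENNReal.ofReal (2 ^ α) * ENNReal.ofReal (powOut (α + p) (4 * R) ‖z‖)) := by
        refine lintegral_mono_ae (hae.mono fun z hz => ?_)
        have n1 := powIn_nonneg α R (norm_nonneg (z - y))
        have n2 := powIn_nonneg p (4 * R) (norm_nonneg z)
        have n3 := powOut_nonneg (α + p) (4 * R) (norm_nonneg z)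
        rw [← ENNReal.ofReal_mul (by positivity), ← ENNReal.ofReal_mul (by positivity),
          ← ENNReal.ofReal_mul (by positivity), ← ENNReal.ofReal_add (by positivity) (by positivity),
          ← ENNReal.ofReal_add (by positivity) (by positivity)]
        exact ENNReal.ofReal_le_ofReal (newton_kernel_le hα0 (by linarith) hε hR hz)
    _ = ENNReal.ofReal (R ^ (-p)) * (∫⁻ z : Euc N, ENNReal.ofReal (powIn α R ‖z‖)) +
          ENNReal.ofReal (R ^ (-α)) * (∫⁻ z : Euc N, ENNReal.ofReal (powIn p (4 * R) ‖z‖)) +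
          ENNReal.ofReal (2 ^ α) *
            (∫⁻ z : Euc N, ENNReal.ofReal (powOut (α + p) (4 * R) ‖z‖)) := by
        rw [lintegral_add_right _ (m3.const_mul _), lintegral_add_right _ (m2.const_mul _),
          lintegral_const_mul _ m1, lintegral_const_mul _ m2, lintegral_const_mul _ m3,
          lintegral_sub_right_eq_self (fun z : Euc N => ENNReal.ofReal (powIn α R ‖z‖)) y]
    _ ≤ ENNReal.ofReal (R ^ (-p)) * ENNReal.ofReal (C1 * R ^ ((N : ℝ) - α)) +
          ENNReal.ofReal (R ^ (-α)) * ENNReal.ofReal (C2 * (4 * R) ^ ((N : ℝ) - p)) +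
          ENNReal.ofReal (2 ^ α) * ENNReal.ofReal (C3 * (4 * R) ^ ((N : ℝ) - (α + p))) := by
        gcongr
        · exact H1 R hR0
        · exact H2 _ (by positivity)
        · exact H3 _ (by positivity)
    _ = ENNReal.ofReal (C * 2 ^ (p - 2) * (ε + ‖y‖) ^ (2 - p)) := by
        rw [← ENNReal.ofReal_mul (by positivity), ← ENNReal.ofReal_mul (by positivity),
          ← ENNReal.ofReal_mul (by positivity), ← ENNReal.ofReal_add (by positivity) (by positivity),
          ← ENNReal.ofReal_add (by positivity) (by positivity)]
        congr 1
        have e0 : ε + ‖y‖ = 2 * R := by rw [hR]; ring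
        have e1 : R ^ (-p) * R ^ ((N : ℝ) - α) = R ^ (2 - p) := by
          rw [← Real.rpow_add hR0, hα]; congr 1; ring
        have e2 : R ^ (-α) * R ^ ((N : ℝ) - p) = R ^ (2 - p) := by
          rw [← Real.rpow_add hR0, hα]; congr 1; ring
        have e3 : (N : ℝ) - (α + p) = 2 - p := by rw [hα]; ring
        have e4 : (2 : ℝ) ^ (p - 2) * 2 ^ (2 - p) = 1 := by
          rw [← Real.rpow_add two_pos]; simp
        rw [e0, e3, Real.mul_rpow (by norm_num) hR0.le, Real.mul_rpow (by norm_num) hR0.le,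
          Real.mul_rpow (by norm_num) hR0.le, hC]
        linear_combination C1 * e1 + C2 * 4 ^ ((N : ℝ) - p) * e2 -
          (C1 + C2 * 4 ^ ((N : ℝ) - p) + 2 ^ α * (C3 * 4 ^ (2 - p))) * R ^ (2 - p) * e4

/-! ### The lattice and the strip -/

lemma abs_apply_le_norm {N : ℕ} (y : Euc N) (i : Fin N) : |y i| ≤ ‖y‖ := by
  simpa using PiLp.norm_apply_le y i

lemma norm_le_norm_of_abs_le {N : ℕ} {y z : Euc N} (h : ∀ i, |y i| ≤ |z i|) : ‖y‖ ≤ ‖z‖ := by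
  rw [EuclideanSpace.norm_eq, EuclideanSpace.norm_eq]
  refine Real.sqrt_le_sqrt (Finset.sum_le_sum fun i _ => ?_)
  simp only [Real.norm_eq_abs]
  exact pow_le_pow_left₀ (abs_nonneg _) (h i) 2

lemma e_apply {N : ℕ} (i l : Fin N) : e N i l = if l = i then 1 else 0 := by
  simp [e]

lemma Qlat_sub {N k : ℕ} {p q : Euc N} (hp : p ∈ Qlat N k) (hq : q ∈ Qlat N k) :
    p - q ∈ Qlat N k := by
  refine ⟨fun i => ?_, fun i hi => by simp [hp.2 i hi, hq.2 i hi]⟩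
  obtain ⟨m, hm⟩ := hp.1 i
  obtain ⟨n, hn⟩ := hq.1 i
  exact ⟨m - n, by simp [hm, hn]⟩

lemma zero_mem_Qlat (N k : ℕ) : (0 : Euc N) ∈ Qlat N k :=
  ⟨fun _ => ⟨0, by simp⟩, fun _ _ => rfl⟩

lemma Qlat_neg {N k : ℕ} {q : Euc N} (hq : q ∈ Qlat N k) : -q ∈ Qlat N k := by
  simpa using Qlat_sub (zero_mem_Qlat N k) hq

lemma Qlat_add {N k : ℕ} {p q : Euc N} (hp : p ∈ Qlat N k) (hq : q ∈ Qlat N k) :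
    p + q ∈ Qlat N k := by
  simpa using Qlat_sub hp (Qlat_neg hq)

lemma e_mem_Qlat {N k : ℕ} {i : Fin N} (hi : (i : ℕ) < k) : e N i ∈ Qlat N k := by
  refine ⟨fun l => ⟨if l = i then 1 else 0, by rw [e_apply]; split_ifs <;> simp⟩, fun l hl => ?_⟩
  rw [e_apply, if_neg]
  rintro rfl
  omega

lemma one_le_norm_of_mem_Qlat {N k : ℕ} {q : Euc N} (hq : q ∈ Qlat N k) (h0 : q ≠ 0) :
    1 ≤ ‖q‖ := by
  obtain ⟨i, hi⟩ : ∃ i, q i ≠ 0 := by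
    by_contra! h
    exact h0 (PiLp.ext h)
  obtain ⟨m, hm⟩ := hq.1 i
  refine le_trans ?_ (abs_apply_le_norm q i)
  have hm0 : m ≠ 0 := by
    rintro rfl
    exact hi (by simpa using hm)
  have h1 : (1 : ℝ) ≤ |(m : ℝ)| := by exact_mod_cast Int.one_le_abs hm0
  rwa [hm]

/-- The lattice `Q_k` as a `ℤ`-submodule. -/
def QlatModule (N k : ℕ) : Submodule ℤ (Euc N) :=
  AddSubgroup.toIntSubmodule
    { carrier := Qlat N k
      zero_mem' := zero_mem_Qlat N k
      add_mem' := Qlat_add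
      neg_mem' := Qlat_neg }

lemma mem_QlatModule {N k : ℕ} {q : Euc N} : q ∈ QlatModule N k ↔ q ∈ Qlat N k := Iff.rfl

instance (N k : ℕ) : DiscreteTopology (QlatModule N k) := by
  refine DiscreteTopology.of_forall_le_dist one_pos fun p q hpq => ?_
  change 1 ≤ dist p q
  rw [Subtype.dist_eq, dist_eq_norm]
  exact one_le_norm_of_mem_Qlat (Qlat_sub (mem_QlatModule.1 p.2) (mem_QlatModule.1 q.2))
    (sub_ne_zero.2 fun h => hpq (Subtype.ext h))

lemma QlatModule_eq_span {N k : ℕ} (hk : k ≤ N) :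
    QlatModule N k = Submodule.span ℤ (Set.range fun i : Fin k => e N (Fin.castLE hk i)) := by
  apply le_antisymm
  · intro q hq
    rw [mem_QlatModule] at hq
    choose m hm using hq.1
    have : q = ∑ i : Fin k, m (Fin.castLE hk i) • e N (Fin.castLE hk i) := by
      ext l
      simp only [WithLp.ofLp_sum, WithLp.ofLp_smul, Finset.sum_apply, Pi.smul_apply, e_apply]
      by_cases hl : (l : ℕ) < k
      · rw [Finset.sum_eq_single (⟨l, hl⟩ : Fin k)]
        · have : Fin.castLE hk ⟨l, hl⟩ = l := rfl
          simp [this, hm]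
        · intro b _ hb
          rw [if_neg, smul_zero]
          rintro rfl
          exact hb rfl
        · simp
      · rw [hq.2 l (by omega), Finset.sum_eq_zero]
        intro b _
        rw [if_neg, smul_zero]
        rintro rfl
        exact hl b.2
    rw [this]
    exact Submodule.sum_mem _ fun i _ =>
      Submodule.smul_mem _ _ (Submodule.subset_span (Set.mem_range_self i))
  · rw [Submodule.span_le]
    rintro _ ⟨i, rfl⟩
    exact e_mem_Qlat i.2

lemma finrank_QlatModule_le {N k : ℕ} (hk : k ≤ N) : Module.finrank ℤ (QlatModule N k) ≤ k := by
  rw [QlatModule_eq_span hk]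
  simpa [Set.finrank] using
    finrank_range_le_card (R := ℤ) fun i : Fin k => e N (Fin.castLE hk i)

namespace LatticeEnum

variable {N k : ℕ} {P : ℕ → Euc N}

lemma mem (hP : LatticeEnum N k P) (j : ℕ) : P j ∈ Qlat N k := by
  rw [← hP.2.1]; exact Set.mem_range_self j

lemma ne_zero (hP : LatticeEnum N k P) {j : ℕ} (hj : j ≠ 0) : P j ≠ 0 := by
  rw [← hP.2.2]; exact hP.1.ne hj

/-- The enumeration as an equivalence. -/
def equiv (hP : LatticeEnum N k P) : ℕ ≃ Qlat N k :=
  (Equiv.ofInjective P hP.1).trans (Equiv.setCongr hP.2.1)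

lemma coe_equiv (hP : LatticeEnum N k P) (j : ℕ) : (hP.equiv j : Euc N) = P j := rfl

/-- The permutation of indices induced by a lattice translation. -/
lemma exists_perm (hP : LatticeEnum N k P) {q : Euc N} (hq : q ∈ Qlat N k) :
    ∃ σ : Equiv.Perm ℕ, ∀ j, P (σ j) = P j + q := by
  let T : Equiv.Perm (Qlat N k) :=
    { toFun := fun p => ⟨p + q, Qlat_add p.2 hq⟩
      invFun := fun p => ⟨p - q, Qlat_sub p.2 hq⟩
      left_inv := fun p => by simp
      right_inv := fun p => by simp }
  refine ⟨(hP.equiv.trans T).trans hP.equiv.symm, fun j => ?_⟩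
  rw [← hP.coe_equiv, ← hP.coe_equiv]
  simp [T]

lemma summable_norm_rpow (hP : LatticeEnum N k P) (hk : k ≤ N) {r : ℝ} (hr : (k : ℝ) < r) :
    Summable fun j => ‖P j‖ ^ (-r) := by
  have h := ZLattice.summable_norm_rpow (QlatModule N k) (-r) (by
    have : (Module.finrank ℤ (QlatModule N k) : ℝ) ≤ k := by
      exact_mod_cast finrank_QlatModule_le hk
    linarith)
  exact (hP.equiv.summable_iff (f := fun q : Qlat N k => ‖(q : Euc N)‖ ^ (-r))).2 h

end LatticeEnum

lemma measurableSet_strip (N k : ℕ) (L : ℝ) : MeasurableSet (strip N k L) := by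
  unfold strip
  simp only [Set.ofPred_forall]
  exact MeasurableSet.iInter fun i => MeasurableSet.iInter fun _ =>
    measurableSet_le (by fun_prop) measurable_const

lemma volume_hyperplane (N : ℕ) (i : Fin N) (c : ℝ) : volume {y : Euc N | y i = c} = 0 := by
  have h := (PiLp.volume_preserving_ofLp (Fin N)).measure_preimage
    (s := {f : Fin N → ℝ | f i = c}) (measurableSet_eq_fun (by fun_prop) (by fun_prop)).nullMeasurableSet
  rw [volume_pi, Measure.pi_hyperplane] at h
  exact h

/-- The strip is the Voronoi cell of the origin for the lattice `L Q_k`. -/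
lemma norm_le_norm_add_of_mem_strip {N k : ℕ} {L : ℝ} {y q : Euc N} (hy : y ∈ strip N k L)
    (hL : 0 ≤ L) (hq : q ∈ Qlat N k) : ‖y‖ ≤ ‖y + L • q‖ := by
  refine norm_le_norm_of_abs_le fun i => ?_
  by_cases hi : (i : ℕ) < k
  · obtain ⟨m, hm⟩ := hq.1 i
    have h1 := hy i hi
    simp only [PiLp.add_apply, PiLp.smul_apply, smul_eq_mul, hm]
    by_cases h0 : m = 0
    · simp [h0]
    · have h2 : (1 : ℝ) ≤ |(m : ℝ)| := by exact_mod_cast Int.one_le_abs h0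
      have h3 : L ≤ |L * m| := by
        rw [abs_mul, abs_of_nonneg hL]; nlinarith
      have h4 : |L * m| ≤ |y i + L * m| + |y i| := by
        have := abs_sub (y i + L * m) (y i)
        simpa using this
      linarith
  · simp [hq.2 i (by omega)]

lemma lattice_norm_le_of_mem_strip {N k : ℕ} {L : ℝ} {y q : Euc N} (hy : y ∈ strip N k L)
    (hL : 1 ≤ L) (hq : q ∈ Qlat N k) : ‖q‖ ≤ 2 * ‖y + L • q‖ := by
  have h1 := norm_le_norm_add_of_mem_strip hy (by linarith) hq
  have h2 : ‖L • q‖ ≤ ‖y + L • q‖ + ‖y‖ := by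
    simpa using norm_sub_le (y + L • q) y
  rw [norm_smul, Real.norm_of_nonneg (by linarith)] at h2
  nlinarith [norm_nonneg q]

lemma tailNorm_le_norm_add {N k : ℕ} (L : ℝ) (y : Euc N) {q : Euc N} (hq : q ∈ Qlat N k) :
    tailNorm k y ≤ ‖y + L • q‖ := by
  rw [EuclideanSpace.norm_eq]
  refine Real.sqrt_le_sqrt (Finset.sum_le_sum fun i _ => ?_)
  split_ifs with hi
  · simp [hq.2 i hi]
  · positivity

/-- Lattice translates of the strip overlap in null sets only. -/
lemma aedisjoint_strip {N k : ℕ} {L : ℝ} (hL : 0 < L) {p q : Euc N} (hp : p ∈ Qlat N k)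
    (hq : q ∈ Qlat N k) (hpq : p ≠ q) :
    AEDisjoint volume ((fun z : Euc N => z - L • p) ⁻¹' strip N k L)
      ((fun z : Euc N => z - L • q) ⁻¹' strip N k L) := by
  obtain ⟨i, hi⟩ : ∃ i, p i ≠ q i := by
    by_contra! h
    exact hpq (PiLp.ext h)
  have hik : (i : ℕ) < k := by
    by_contra h
    exact hi (by rw [hp.2 i (by omega), hq.2 i (by omega)])
  refine measure_mono_null (t := {z : Euc N | z i = L * (p i + q i) / 2}) ?_
    (volume_hyperplane N i _)
  rintro z ⟨h1, h2⟩
  have h1 := abs_le.1 (h1 i hik)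
  have h2 := abs_le.1 (h2 i hik)
  simp only [PiLp.sub_apply, PiLp.smul_apply, smul_eq_mul] at h1 h2
  obtain ⟨m, hm⟩ := hp.1 i
  obtain ⟨n, hn⟩ := hq.1 i
  have hmn : m ≠ n := by
    rintro rfl
    exact hi (hm.trans hn.symm)
  simp only [Set.mem_ofPred_eq]
  rcases lt_or_gt_of_ne hmn with h | h
  · have h3 : p i + 1 ≤ q i := by
      have : (m : ℝ) + 1 ≤ n := by exact_mod_cast h
      rwa [hm, hn]
    have h4 := mul_nonneg hL.le (sub_nonneg.2 h3)
    linarith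
  · have h3 : q i + 1 ≤ p i := by
      have : (n : ℝ) + 1 ≤ m := by exact_mod_cast h
      rwa [hm, hn]
    have h4 := mul_nonneg hL.le (sub_nonneg.2 h3)
    linarith

/-- Unfolding: an integral over the strip of a product of lattice periodizations is bounded by
the sum of the integrals over the whole space. -/
lemma lintegral_strip_periodization_le {N k : ℕ} {P : ℕ → Euc N} (hP : LatticeEnum N k P) {L : ℝ}
    (hL : 0 < L) {A B : Euc N → ENNReal} (hA : Measurable A) (hB : Measurable B) :
    ∫⁻ z in strip N k L, (∑' i, A (z + L • P i)) * ∑' j, B (z + L • P j) ≤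
      ∑' j, ∫⁻ z, A z * B (z + L • P j) := by
  set W : Euc N → ENNReal := fun z => ∑' j, B (z + L • P j) with hW
  have hWm : Measurable W := Measurable.tsum fun j => hB.comp (by fun_prop)
  have hWp : ∀ i z, W (z + L • P i) = W z := by
    intro i z
    obtain ⟨ρ, hρ⟩ := hP.exists_perm (hP.mem i)
    simp only [hW]
    rw [← Equiv.tsum_eq ρ (fun j => B (z + L • P j))]
    refine tsum_congr fun j => ?_
    rw [hρ, smul_add, add_assoc, add_comm (L • P i)]
  calc ∫⁻ z in strip N k L, (∑' i, A (z + L • P i)) * W z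
      = ∫⁻ z in strip N k L, ∑' i, A (z + L • P i) * W (z + L • P i) := by
        refine lintegral_congr fun z => ?_
        rw [← ENNReal.tsum_mul_right]
        simp only [hWp]
    _ = ∑' i, ∫⁻ z in strip N k L, A (z + L • P i) * W (z + L • P i) :=
        lintegral_tsum fun i => ((hA.mul hWm).comp (by fun_prop :
          Measurable fun z : Euc N => z + L • P i)).aemeasurable
    _ = ∑' i, ∫⁻ z in (fun z : Euc N => z - L • P i) ⁻¹' strip N k L, A z * W z := by
        refine tsum_congr fun i => ?_
        have h := (measurePreserving_sub_right (volume : Measure (Euc N)) (L • P i)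
          ).setLIntegral_comp_preimage_emb
            (MeasurableEquiv.subRight (L • P i)).measurableEmbedding
            (fun z => A (z + L • P i) * W (z + L • P i)) (strip N k L)
        rw [← h]
        simp
    _ = ∫⁻ z in ⋃ i, (fun z : Euc N => z - L • P i) ⁻¹' strip N k L, A z * W z := by
        rw [lintegral_iUnion₀]
        · exact fun i => (((by fun_prop : Measurable fun z : Euc N => z - L • P i))
            (measurableSet_strip N k L)).nullMeasurableSet
        · exact fun i j hij => aedisjoint_strip hL (hP.mem i) (hP.mem j) (hP.1.ne hij)
    _ ≤ ∫⁻ z, A z * W z := setLIntegral_le_lintegral _ _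
    _ = ∫⁻ z, ∑' j, A z * B (z + L • P j) := by simp only [hW, ENNReal.tsum_mul_left]
    _ = ∑' j, ∫⁻ z, A z * B (z + L • P j) :=
        lintegral_tsum fun j => (hA.mul (hB.comp (by fun_prop))).aemeasurable

/-! ### Lattice weights -/

/-- The cut-off `min {1, t ^ s}`. -/
def cut (s t : ℝ) : ℝ := min 1 (t ^ s)

lemma cut_nonneg (s : ℝ) {t : ℝ} (ht : 0 ≤ t) : 0 ≤ cut s t :=
  le_min zero_le_one (Real.rpow_nonneg ht s)

lemma cut_pos (s : ℝ) {t : ℝ} (ht : 0 < t) : 0 < cut s t :=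
  lt_min one_pos (Real.rpow_pos_of_pos ht s)

lemma cut_le_one (s t : ℝ) : cut s t ≤ 1 := min_le_left _ _

lemma measurable_cut (s : ℝ) : Measurable (cut s) := by
  unfold cut; fun_prop

lemma cut_le_of_le_three_mul {s t t' : ℝ} (hs : 0 ≤ s) (ht : 0 ≤ t) (ht' : 0 ≤ t')
    (h : t ≤ 3 * t') : cut s t ≤ 3 ^ s * cut s t' := by
  have h3 : (1 : ℝ) ≤ 3 ^ s := Real.one_le_rpow (by norm_num) hs
  unfold cut
  rw [mul_min_of_nonneg _ _ (by positivity), mul_one, ← Real.mul_rpow (by norm_num) ht']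
  exact min_le_min h3 (Real.rpow_le_rpow ht h hs)

lemma cut_mul_rpow {s t p : ℝ} (ht : 0 < t) :
    cut s t * t ^ (-p) = min (t ^ (-p)) (t ^ (-(p - s))) := by
  rw [cut, min_mul_of_nonneg _ _ (by positivity), one_mul, ← Real.rpow_add ht]
  congr 2
  ring

/-- The distance `ε + |y - x_j|`, with `x_j = x - L P_j`. -/
def latDist {N : ℕ} (ε L : ℝ) (P : ℕ → Euc N) (x y : Euc N) (j : ℕ) : ℝ :=
  ε + ‖y + L • P j - x‖

/-- The weight `min {1, (ε + |y - x|) ^ s} Σ_j (ε + |y - x_j|) ^ (-q)`. -/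
def latWeight {N : ℕ} (s q ε L : ℝ) (P : ℕ → Euc N) (x y : Euc N) : ℝ :=
  cut s (ε + ‖y - x‖) * ∑' j, latDist ε L P x y j ^ (-q)

section latDist

variable {N k : ℕ} {P : ℕ → Euc N} {ε L : ℝ} {x y : Euc N}

lemma latDist_pos (hε : 0 < ε) (j : ℕ) : 0 < latDist ε L P x y j := by
  unfold latDist
  positivity

lemma latDist_zero (hP : LatticeEnum N k P) : latDist ε L P x y 0 = ε + ‖y - x‖ := by
  simp [latDist, hP.2.2]

lemma norm_add_le_latDist (hx : ‖x‖ ≤ ε) (j : ℕ) : ‖y + L • P j‖ ≤ latDist ε L P x y j := by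
  have := norm_add_le (y + L • P j - x) x
  rw [sub_add_cancel] at this
  unfold latDist
  linarith

lemma tailNorm_le_latDist (hP : LatticeEnum N k P) (hx : ‖x‖ ≤ ε) (j : ℕ) :
    tailNorm k y ≤ latDist ε L P x y j :=
  (tailNorm_le_norm_add L y (hP.mem j)).trans (norm_add_le_latDist hx j)

lemma dist_le_three_mul_latDist (hP : LatticeEnum N k P) (hL : 1 ≤ L) (hx : ‖x‖ ≤ ε)
    (hy : y ∈ strip N k L) (j : ℕ) : ε + ‖y - x‖ ≤ 3 * latDist ε L P x y j := by
  have h1 := norm_le_norm_add_of_mem_strip hy (by linarith) (hP.mem j)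
  have h2 := norm_add_le_latDist (P := P) (L := L) (y := y) hx j
  have h3 := norm_sub_le y x
  have h4 : ε ≤ latDist ε L P x y j := le_add_of_nonneg_right (norm_nonneg _)
  linarith

lemma norm_le_two_mul_latDist (hP : LatticeEnum N k P) (hL : 1 ≤ L) (hx : ‖x‖ ≤ ε)
    (hy : y ∈ strip N k L) (j : ℕ) : ‖P j‖ ≤ 2 * latDist ε L P x y j := by
  have h1 := lattice_norm_le_of_mem_strip hy hL (hP.mem j)
  have h2 := norm_add_le_latDist (P := P) (L := L) (y := y) hx j
  linarith

lemma latDist_rpow_le (hP : LatticeEnum N k P) (hL : 1 ≤ L) (hx : ‖x‖ ≤ ε)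
    (hy : y ∈ strip N k L) {r : ℝ} (hr : 0 ≤ r) {j : ℕ} (hj : j ≠ 0) :
    latDist ε L P x y j ^ (-r) ≤ 2 ^ r * ‖P j‖ ^ (-r) := by
  have h0 : 0 < ‖P j‖ := norm_pos_iff.2 (hP.ne_zero hj)
  have h1 : ‖P j‖ / 2 ≤ latDist ε L P x y j := by
    have := norm_le_two_mul_latDist hP hL hx hy j
    linarith
  calc latDist ε L P x y j ^ (-r) ≤ (‖P j‖ / 2) ^ (-r) :=
        Real.rpow_le_rpow_of_nonpos (by positivity) h1 (by linarith)
    _ = 2 ^ r * ‖P j‖ ^ (-r) := by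
        rw [Real.div_rpow h0.le (by norm_num), Real.rpow_neg (by norm_num : (0 : ℝ) ≤ 2)]
        field_simp

/-- Comparison of sums over the lattice translates, for summands dominated by a power. -/
lemma summable_and_tsum_le (hP : LatticeEnum N k P) (hk : k ≤ N) (hL : 1 ≤ L)
    (hx : ‖x‖ ≤ ε) (hy : y ∈ strip N k L) {r : ℝ} (hr : (k : ℝ) < r) {b : ℕ → ℝ}
    (hb0 : ∀ j, 0 ≤ b j) (hb : ∀ j, b j ≤ latDist ε L P x y j ^ (-r)) :
    Summable b ∧ ∑' j, b j ≤ b 0 + 2 ^ r * ∑' j, ‖P j‖ ^ (-r) := by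
  have hr0 : 0 ≤ r := (Nat.cast_nonneg k).trans hr.le
  have hs := (hP.summable_norm_rpow hk hr).mul_left (2 ^ r)
  have hsingle := hasSum_ite_eq (0 : ℕ) (b 0)
  have hle : ∀ j, b j ≤ (if j = 0 then b 0 else 0) + 2 ^ r * ‖P j‖ ^ (-r) := by
    intro j
    by_cases hj : j = 0
    · subst hj
      simp only [if_true]
      have : 0 ≤ 2 ^ r * ‖P 0‖ ^ (-r) := by positivity
      linarith
    · simpa [hj] using (hb j).trans (latDist_rpow_le hP hL hx hy hr0 hj)
  have hsum := hsingle.summable.add hs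
  have hbs : Summable b := Summable.of_nonneg_of_le hb0 hle hsum
  refine ⟨hbs, (hbs.tsum_le_tsum hle hsum).trans (le_of_eq ?_)⟩
  rw [hsingle.summable.tsum_add hs, hsingle.tsum_eq, tsum_mul_left]

lemma summable_latDist_rpow (hP : LatticeEnum N k P) (hk : k ≤ N) (hε : 0 < ε) (hL : 1 ≤ L)
    (hx : ‖x‖ ≤ ε) (hy : y ∈ strip N k L) {r : ℝ} (hr : (k : ℝ) < r) :
    Summable fun j => latDist ε L P x y j ^ (-r) :=
  (summable_and_tsum_le hP hk hL hx hy hr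
    (fun j => Real.rpow_nonneg (latDist_pos hε j).le _) fun _ => le_rfl).1

lemma latWeight_pos (hP : LatticeEnum N k P) (hk : k ≤ N) (hε : 0 < ε) (hL : 1 ≤ L)
    (hx : ‖x‖ ≤ ε) (hy : y ∈ strip N k L) (s : ℝ) {q : ℝ} (hq : (k : ℝ) < q) :
    0 < latWeight s q ε L P x y :=
  mul_pos (cut_pos s (by positivity))
    ((summable_latDist_rpow hP hk hε hL hx hy hq).tsum_pos
      (fun j => Real.rpow_nonneg (latDist_pos hε j).le _) 0
      (Real.rpow_pos_of_pos (latDist_pos hε 0) _))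

lemma latWeight_lt_of_tailNorm_large (hP : LatticeEnum N k P) (hk : k ≤ N) (hε : 0 < ε)
    (hL : 1 ≤ L) (hx : ‖x‖ ≤ ε) (s : ℝ) {r t : ℝ} (hr : (k : ℝ) < r) (ht : 0 < t) {δ : ℝ}
    (hδ : 0 < δ) :
    ∃ R : ℝ, ∀ y ∈ strip N k L, R ≤ tailNorm k y → latWeight s (r + t) ε L P x y < δ := by
  set M := 1 + 2 ^ r * ∑' j, ‖P j‖ ^ (-r) with hM
  have hMt : Tendsto (fun R : ℝ => R ^ (-t) * M) atTop (𝓝 (0 * M)) :=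
    (tendsto_rpow_neg_atTop ht).mul_const M
  rw [zero_mul] at hMt
  obtain ⟨R, hRδ, hR1⟩ := ((hMt.eventually (gt_mem_nhds hδ)).and (eventually_ge_atTop 1)).exists
  refine ⟨R, fun y hy hyR => lt_of_le_of_lt ?_ hRδ⟩
  have hD : ∀ j, R ≤ latDist ε L P x y j := fun j => hyR.trans (tailNorm_le_latDist hP hx j)
  have hr0 : 0 ≤ r := (Nat.cast_nonneg k).trans hr.le
  obtain ⟨hs, hle⟩ := summable_and_tsum_le hP hk hL hx hy hr
    (fun j => Real.rpow_nonneg (latDist_pos hε j).le _) fun _ => le_rfl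
  have hD0 : latDist ε L P x y 0 ^ (-r) ≤ 1 :=
    Real.rpow_le_one_of_one_le_of_nonpos (hR1.trans (hD 0)) (by linarith)
  have hterm : ∀ j, latDist ε L P x y j ^ (-(r + t)) ≤ R ^ (-t) * latDist ε L P x y j ^ (-r) := by
    intro j
    rw [neg_add, Real.rpow_add (latDist_pos hε j), mul_comm]
    exact mul_le_mul_of_nonneg_right
      (Real.rpow_le_rpow_of_nonpos (by linarith) (hD j) (by linarith))
      (Real.rpow_nonneg (latDist_pos hε j).le _)
  have hs' := summable_latDist_rpow hP hk hε hL hx hy (r := r + t) (by linarith)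
  calc latWeight s (r + t) ε L P x y
      ≤ 1 * ∑' j, latDist ε L P x y j ^ (-(r + t)) := by
        unfold latWeight
        gcongr
        · exact tsum_nonneg fun j => Real.rpow_nonneg (latDist_pos hε j).le _
        · exact cut_le_one _ _
    _ ≤ ∑' j, R ^ (-t) * latDist ε L P x y j ^ (-r) := by
        rw [one_mul]
        exact hs'.tsum_le_tsum hterm (hs.mul_left _)
    _ ≤ R ^ (-t) * M := by
        rw [tsum_mul_left]
        gcongr
        linarith

/-- Localizing the cut-off at every translated centre costs only a constant factor. -/
lemma tsum_cut_mul_rpow_le (hP : LatticeEnum N k P) (hk : k ≤ N) (hε : 0 < ε) (hL : 1 ≤ L)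
    (hx : ‖x‖ ≤ ε) (hy : y ∈ strip N k L) {s a : ℝ} (ha : (k : ℝ) < a) (hs0 : 0 ≤ s)
    (hsa : s ≤ a) :
    ∑' j, cut s (latDist ε L P x y j) * latDist ε L P x y j ^ (-a) ≤
      (1 + 2 ^ a * ∑' j, ‖P j‖ ^ (-a)) * latWeight s a ε L P x y := by
  have hK : 0 ≤ 2 ^ a * ∑' j, ‖P j‖ ^ (-a) := by positivity
  set K := 2 ^ a * ∑' j, ‖P j‖ ^ (-a)
  set T := latDist ε L P x y with hT
  have hTp : ∀ j, 0 < T j := latDist_pos hε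
  have hTn : ∀ j, 0 ≤ T j ^ (-a) := fun j => Real.rpow_nonneg (hTp j).le _
  have hle : ∀ j, cut s (T j) * T j ^ (-a) ≤ T j ^ (-a) := fun j =>
    mul_le_of_le_one_left (hTn j) (cut_le_one _ _)
  have hs := summable_latDist_rpow hP hk hε hL hx hy ha
  obtain ⟨hbs, hb⟩ := summable_and_tsum_le hP hk hL hx hy ha
    (fun j => mul_nonneg (cut_nonneg s (hTp j).le) (hTn j)) hle
  have hW : latWeight s a ε L P x y = cut s (T 0) * ∑' j, T j ^ (-a) := by
    rw [latWeight, hT, latDist_zero hP]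
  have hWpos := latWeight_pos hP hk hε hL hx hy s ha
  by_cases h1 : 1 ≤ cut s (T 0)
  · have hc : cut s (T 0) = 1 := le_antisymm (cut_le_one _ _) h1
    have : ∑' j, cut s (T j) * T j ^ (-a) ≤ latWeight s a ε L P x y := by
      rw [hW, hc, one_mul]
      exact hbs.tsum_le_tsum hle hs
    nlinarith
  · have hc : cut s (T 0) = T 0 ^ s := by
      rcases min_choice 1 (T 0 ^ s) with h | h
      · exact absurd h.ge h1
      · exact h
    have hlt : cut s (T 0) * T 0 ^ (-a) ≤ latWeight s a ε L P x y := by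
      rw [hW]
      have := hs.le_tsum 0 fun j _ => hTn j
      have := cut_nonneg s (hTp 0).le
      gcongr
    have hT1 : T 0 < 1 := by
      by_contra! h
      exact h1 (le_min le_rfl (Real.one_le_rpow h hs0))
    have h2 : 1 ≤ latWeight s a ε L P x y := by
      refine le_trans ?_ hlt
      rw [hc, ← Real.rpow_add (hTp 0)]
      exact Real.one_le_rpow_of_pos_of_le_one_of_nonpos (hTp 0) hT1.le (by linarith)
    nlinarith

end latDist

/-! ### The weighted estimate for the Green potential -/

lemma ofReal_tsum_le {f : ℕ → ℝ} (hf : ∀ j, 0 ≤ f j) :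
    ENNReal.ofReal (∑' j, f j) ≤ ∑' j, ENNReal.ofReal (f j) := by
  by_cases h : Summable f
  · exact (ENNReal.ofReal_tsum_of_nonneg hf h).le
  · simp [tsum_eq_zero_of_not_summable h]

/-- The Newtonian potential of a single cut-off bubble weight. -/
lemma newton_potential_cut_le {N : ℕ} (hN : 3 ≤ N) {s a : ℝ} (hs0 : 0 < s) (hsa : s < a)
    (haN : a + 2 < N) :
    ∃ C : ℝ, 0 ≤ C ∧ ∀ ε : ℝ, 0 < ε → ∀ y c : Euc N,
      ∫⁻ z : Euc N, ENNReal.ofReal (‖z - y‖ ^ (-((N : ℝ) - 2))) *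
          ENNReal.ofReal (cut s (ε + ‖z - c‖) * (ε + ‖z - c‖) ^ (-(a + 2))) ≤
        ENNReal.ofReal (C * (cut s (ε + ‖y - c‖) * (ε + ‖y - c‖) ^ (-a))) := by
  obtain ⟨C1, hC1, H1⟩ := newton_potential_le hN (p := a + 2) (by linarith) haN
  obtain ⟨C2, hC2, H2⟩ := newton_potential_le hN (p := a + 2 - s) (by linarith) (by linarith)
  refine ⟨max C1 C2, le_max_of_le_left hC1, fun ε hε y c => ?_⟩
  have hT : 0 < ε + ‖y - c‖ := by positivity
  have hbound : ∀ p C : ℝ, 0 ≤ C → C ≤ max C1 C2 →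
      (∀ z : Euc N, cut s (ε + ‖z - c‖) * (ε + ‖z - c‖) ^ (-(a + 2)) ≤ (ε + ‖z - c‖) ^ (-p)) →
      (∫⁻ z : Euc N, ENNReal.ofReal (‖z - y‖ ^ (-((N : ℝ) - 2)) * (ε + ‖z - c‖) ^ (-p)) ≤
        ENNReal.ofReal (C * (ε + ‖y - c‖) ^ (2 - p))) →
      ∫⁻ z : Euc N, ENNReal.ofReal (‖z - y‖ ^ (-((N : ℝ) - 2))) *
          ENNReal.ofReal (cut s (ε + ‖z - c‖) * (ε + ‖z - c‖) ^ (-(a + 2))) ≤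
        ENNReal.ofReal (max C1 C2 * (ε + ‖y - c‖) ^ (2 - p)) := by
    intro p C hC hCm hle hint
    refine (lintegral_mono fun z => ?_).trans (hint.trans (ENNReal.ofReal_le_ofReal ?_))
    · rw [← ENNReal.ofReal_mul (by positivity)]
      exact ENNReal.ofReal_le_ofReal (mul_le_mul_of_nonneg_left (hle z) (by positivity))
    · gcongr
  have h1 := hbound (a + 2) C1 hC1 (le_max_left _ _) (fun z => by
    rw [cut_mul_rpow (by positivity)]; exact min_le_left _ _) (H1 ε hε y c)
  have h2 := hbound (a + 2 - s) C2 hC2 (le_max_right _ _) (fun z => by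
    rw [cut_mul_rpow (by positivity)]; exact min_le_right _ _) (H2 ε hε y c)
  rw [cut_mul_rpow hT, mul_min_of_nonneg _ _ (le_max_of_le_left hC1), ENNReal.ofReal_min]
  refine le_min ?_ ?_
  · rwa [show 2 - (a + 2) = -a by ring] at h1
  · rwa [show 2 - (a + 2 - s) = -(a - s) by ring] at h2

/-- The Green potential maps the weight of order `a + 2` to the weight of order `a`. -/
lemma lintegral_green_latWeight_le {N k : ℕ} {P : ℕ → Euc N} (hP : LatticeEnum N k P) (hN : 3 ≤ N)
    (hk : k ≤ N) {s a : ℝ} (hs0 : 0 < s) (hsa : s < a) (hka : (k : ℝ) < a) (haN : a + 2 < N) :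
    ∃ C : ℝ, 0 ≤ C ∧ ∀ (ε L : ℝ) (x y : Euc N), 0 < ε → 1 ≤ L → ‖x‖ ≤ ε → y ∈ strip N k L →
      ∫⁻ z in strip N k L, (∑' i, ENNReal.ofReal (‖z + L • P i - y‖ ^ (-((N : ℝ) - 2)))) *
          ENNReal.ofReal (latWeight s (a + 2) ε L P x z) ≤
        ENNReal.ofReal (C * latWeight s a ε L P x y) := by
  obtain ⟨C, hC, H⟩ := newton_potential_cut_le hN hs0 hsa haN
  refine ⟨3 ^ s * (C * (1 + 2 ^ a * ∑' j, ‖P j‖ ^ (-a))), by positivity,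
    fun ε L x y hε hL hx hy => ?_⟩
  have hL0 : 0 < L := by linarith
  set A : Euc N → ENNReal := fun z => ENNReal.ofReal (‖z - y‖ ^ (-((N : ℝ) - 2))) with hA
  set B : Euc N → ENNReal := fun z =>
    ENNReal.ofReal (cut s (ε + ‖z - x‖) * (ε + ‖z - x‖) ^ (-(a + 2))) with hB
  have hAm : Measurable A := by fun_prop
  have hdm : Measurable fun z : Euc N => ε + ‖z - x‖ := by fun_prop
  have hBm : Measurable B := (((measurable_cut s).comp hdm).mul (hdm.pow_const _)).ennreal_ofReal
  have hW : ∀ z ∈ strip N k L, ENNReal.ofReal (latWeight s (a + 2) ε L P x z) ≤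
      ENNReal.ofReal (3 ^ s) * ∑' j, B (z + L • P j) := by
    intro z hz
    rw [latWeight, ENNReal.ofReal_mul (cut_nonneg s (by positivity)), ← ENNReal.tsum_mul_left]
    refine (mul_le_mul_right (ofReal_tsum_le fun j =>
      Real.rpow_nonneg (latDist_pos hε j).le _) _).trans ?_
    rw [← ENNReal.tsum_mul_left]
    refine ENNReal.tsum_le_tsum fun j => ?_
    rw [← ENNReal.ofReal_mul (cut_nonneg s (by positivity)), hB,
      ← ENNReal.ofReal_mul (by positivity)]
    refine ENNReal.ofReal_le_ofReal ?_
    rw [← mul_assoc]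
    exact mul_le_mul_of_nonneg_right (cut_le_of_le_three_mul hs0.le (by positivity)
      (latDist_pos hε j).le (dist_le_three_mul_latDist hP hL hx hz j))
      (Real.rpow_nonneg (latDist_pos hε j).le _)
  have hTn : ∀ j, 0 ≤ cut s (latDist ε L P x y j) * latDist ε L P x y j ^ (-a) := fun j =>
    mul_nonneg (cut_nonneg s (latDist_pos hε j).le) (Real.rpow_nonneg (latDist_pos hε j).le _)
  have hsum := (summable_and_tsum_le hP hk hL hx hy hka hTn fun j =>
    mul_le_of_le_one_left (Real.rpow_nonneg (latDist_pos hε j).le _) (cut_le_one _ _)).1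
  calc ∫⁻ z in strip N k L, (∑' i, A (z + L • P i)) *
          ENNReal.ofReal (latWeight s (a + 2) ε L P x z)
      ≤ ∫⁻ z in strip N k L, ENNReal.ofReal (3 ^ s) *
          ((∑' i, A (z + L • P i)) * ∑' j, B (z + L • P j)) := by
        refine setLIntegral_mono' (measurableSet_strip N k L) fun z hz => ?_
        rw [mul_left_comm]
        exact mul_le_mul_right (hW z hz) _
    _ = ENNReal.ofReal (3 ^ s) * ∫⁻ z in strip N k L,
          (∑' i, A (z + L • P i)) * ∑' j, B (z + L • P j) :=
        lintegral_const_mul' _ _ ENNReal.ofReal_ne_top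
    _ ≤ ENNReal.ofReal (3 ^ s) * ∑' j, ∫⁻ z, A z * B (z + L • P j) := by
        gcongr
        exact lintegral_strip_periodization_le hP hL0 hAm hBm
    _ ≤ ENNReal.ofReal (3 ^ s) * ∑' j, ENNReal.ofReal
          (C * (cut s (latDist ε L P x y j) * latDist ε L P x y j ^ (-a))) := by
        gcongr with j
        have h := H ε hε y (x - L • P j)
        have he : ∀ w : Euc N, w - (x - L • P j) = w + L • P j - x := fun w => by abel
        simp only [he] at h
        exact h
    _ = ENNReal.ofReal (3 ^ s * (C * ∑' j, cut s (latDist ε L P x y j) *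
          latDist ε L P x y j ^ (-a))) := by
        rw [← tsum_mul_left, ENNReal.ofReal_mul (by positivity),
          ENNReal.ofReal_tsum_of_nonneg (fun j => mul_nonneg hC (hTn j)) (hsum.mul_left C)]
    _ ≤ ENNReal.ofReal (3 ^ s * (C * (1 + 2 ^ a * ∑' j, ‖P j‖ ^ (-a))) *
          latWeight s a ε L P x y) := by
        refine ENNReal.ofReal_le_ofReal ?_
        rw [mul_assoc, mul_assoc]
        gcongr
        exact tsum_cut_mul_rpow_le hP hk hε hL hx hy hka hs0.le hsa.le

/-! ### The weights and norms of the statement -/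

lemma one_add_mul_eq {μ t : ℝ} (hμ : 0 < μ) : 1 + μ * t = μ * (μ⁻¹ + t) := by
  field_simp

lemma σw_eq_cut {N : ℕ} {μ : ℝ} (hμ : 0 < μ) (τ : ℝ) (x y : Euc N) :
    σw x μ τ y = cut (τ - 1) (μ⁻¹ + ‖y - x‖) := by
  rw [σw, one_add_mul_eq hμ, mul_div_cancel_left₀ _ hμ.ne', cut]

lemma bubble_weight_eq {N : ℕ} {μ : ℝ} (hμ : 0 < μ) (L : ℝ) (P : ℕ → Euc N) (x y : Euc N)
    (b τ : ℝ) (j : ℕ) :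
    μ ^ b / (1 + μ * ‖y - xc L P x j‖) ^ (b + τ) =
      μ ^ (-τ) * latDist μ⁻¹ L P x y j ^ (-(b + τ)) := by
  have he : y - xc L P x j = y + L • P j - x := by
    rw [xc]; abel
  have hD : 0 < latDist μ⁻¹ L P x y j := latDist_pos (inv_pos.2 hμ) j
  rw [he, one_add_mul_eq hμ, ← latDist, Real.mul_rpow hμ.le hD.le, Real.rpow_neg hD.le,
    Real.rpow_neg hμ.le, Real.rpow_add hμ]
  have := (Real.rpow_pos_of_pos hμ b).ne'
  field_simp

lemma wStar_eq {N : ℕ} {μ : ℝ} (hμ : 0 < μ) (L : ℝ) (P : ℕ → Euc N) (x y : Euc N) (τ : ℝ) :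
    wStar N L P x μ τ y =
      μ ^ (-τ) * latWeight (τ - 1) (((N : ℝ) - 2) / 2 + τ) μ⁻¹ L P x y := by
  simp only [wStar, latWeight, bubble_weight_eq hμ, tsum_mul_left, σw_eq_cut hμ]
  ring

lemma wStarStar_eq {N : ℕ} {μ : ℝ} (hμ : 0 < μ) (L : ℝ) (P : ℕ → Euc N) (x y : Euc N) (τ : ℝ) :
    wStarStar N L P x μ τ y =
      μ ^ (-τ) * latWeight (τ - 1) (((N : ℝ) - 2) / 2 + τ + 2) μ⁻¹ L P x y := by
  simp only [wStarStar, latWeight, bubble_weight_eq hμ, tsum_mul_left, σw_eq_cut hμ]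
  rw [show ((N : ℝ) - 2) / 2 + τ + 2 = ((N : ℝ) + 2) / 2 + τ by ring]
  ring

/-- The constant of the fundamental solution. -/
def ΓConst (N : ℕ) : ℝ := 1 / (((N : ℝ) - 2) * sphereArea N)

lemma ΓConst_nonneg {N : ℕ} (hN : 2 ≤ N) : 0 ≤ ΓConst N := by
  have : (2 : ℝ) ≤ N := by exact_mod_cast hN
  have : 0 ≤ sphereArea N := by unfold sphereArea; positivity
  exact one_div_nonneg.2 (mul_nonneg (by linarith) this)

lemma Γfun_eq {N : ℕ} (y z : Euc N) : Γfun N y z = ΓConst N * ‖y - z‖ ^ (-((N : ℝ) - 2)) := by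
  rw [Γfun, ΓConst, Real.rpow_neg (norm_nonneg _), ← one_div, div_mul_div_comm, one_mul]

lemma enorm_Green_le {N : ℕ} (hN : 2 ≤ N) (L : ℝ) (P : ℕ → Euc N) (y z : Euc N) :
    ‖Green N L P z y‖ₑ ≤ ENNReal.ofReal (ΓConst N) *
      ∑' i, ENNReal.ofReal (‖z + L • P i - y‖ ^ (-((N : ℝ) - 2))) := by
  have hn : ∀ i, 0 ≤ Γfun N (z + L • P i) y := fun i => by
    rw [Γfun_eq]
    exact mul_nonneg (ΓConst_nonneg hN) (by positivity)
  rw [Green, Real.enorm_of_nonneg (tsum_nonneg hn), ← ENNReal.tsum_mul_left]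
  refine (ofReal_tsum_le hn).trans (le_of_eq (tsum_congr fun i => ?_))
  rw [Γfun_eq, ENNReal.ofReal_mul (ΓConst_nonneg hN)]

lemma Green_add_lattice {N k : ℕ} {P : ℕ → Euc N} (hP : LatticeEnum N k P) (L : ℝ)
    (z y : Euc N) {q : Euc N} (hq : q ∈ Qlat N k) :
    Green N L P z (y + L • q) = Green N L P z y := by
  obtain ⟨ρ, hρ⟩ := hP.exists_perm (Qlat_neg hq)
  rw [Green, Green, ← Equiv.tsum_eq ρ fun j => Γfun N (z + L • P j) y]
  refine tsum_congr fun j => ?_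
  rw [Γfun_eq, Γfun_eq, hρ, smul_add, smul_neg]
  congr 3
  abel

lemma invLap_add_period {N k : ℕ} {P : ℕ → Euc N} (hP : LatticeEnum N k P) (L : ℝ)
    (f : Euc N → ℝ) {i : Fin N} (hi : (i : ℕ) < k) (y : Euc N) :
    invLap N k L P f (y + L • e N i) = invLap N k L P f y := by
  simp only [invLap, Green_add_lattice hP L _ _ (e_mem_Qlat hi)]

lemma pd_add_period {N : ℕ} {u : Euc N → ℝ} {a : Euc N} (hu : ∀ y, u (y + a) = u y) (i : Fin N)
    (y : Euc N) : pd i u (y + a) = pd i u y := by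
  rw [pd, pd, ← fderiv_comp_add_right]
  simp only [hu]

/-- The pointwise bound for the Green potential. -/
lemma abs_invLap_le {N k : ℕ} {P : ℕ → Euc N} (hP : LatticeEnum N k P) (hN : 3 ≤ N)
    (hk1 : 1 ≤ k) (hk : k ≤ N) {τ : ℝ} (hτk : (k : ℝ) < τ) (hτN : τ < ((N : ℝ) - 2) / 2) :
    ∃ C : ℝ, 0 < C ∧ ∀ (L μ : ℝ) (x : Euc N), 0 < μ → 1 ≤ L → ‖x‖ ≤ μ⁻¹ →
      ∀ (f : Euc N → ℝ) (F : ℝ), 0 ≤ F →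
        (∀ z ∈ strip N k L, |f z| ≤ F * wStarStar N L P x μ τ z) →
        ∀ y ∈ strip N k L, |invLap N k L P f y| ≤ C * F * wStar N L P x μ τ y := by
  have hkr : (1 : ℝ) ≤ k := by exact_mod_cast hk1
  obtain ⟨C, hC, H⟩ := lintegral_green_latWeight_le hP hN hk (s := τ - 1)
    (a := ((N : ℝ) - 2) / 2 + τ) (by linarith) (by linarith) (by linarith) (by linarith)
  have hG := ΓConst_nonneg (N := N) (by omega)
  refine ⟨ΓConst N * C + 1, by positivity, fun L μ x hμ hL hx f F hF hf y hy => ?_⟩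
  have hε : 0 < μ⁻¹ := inv_pos.2 hμ
  have hM : 0 ≤ F * μ ^ (-τ) := by positivity
  have hW : 0 < wStar N L P x μ τ y := by
    rw [wStar_eq hμ]
    exact mul_pos (Real.rpow_pos_of_pos hμ _)
      (latWeight_pos hP hk hε hL hx hy _ (by linarith))
  have key : ‖invLap N k L P f y‖ₑ ≤ ENNReal.ofReal (ΓConst N * C * F * wStar N L P x μ τ y) := by
    calc ‖invLap N k L P f y‖ₑ
        ≤ ∫⁻ z in strip N k L, ‖Green N L P z y * f z‖ₑ := enorm_integral_le_lintegral_enorm _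
      _ ≤ ∫⁻ z in strip N k L, ENNReal.ofReal (ΓConst N * (F * μ ^ (-τ))) *
            ((∑' i, ENNReal.ofReal (‖z + L • P i - y‖ ^ (-((N : ℝ) - 2)))) *
              ENNReal.ofReal
                (latWeight (τ - 1) (((N : ℝ) - 2) / 2 + τ + 2) μ⁻¹ L P x z)) := by
          refine setLIntegral_mono' (measurableSet_strip N k L) fun z hz => ?_
          have hfz : ‖f z‖ₑ ≤ ENNReal.ofReal (F * μ ^ (-τ)) * ENNReal.ofReal
              (latWeight (τ - 1) (((N : ℝ) - 2) / 2 + τ + 2) μ⁻¹ L P x z) := by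
            rw [← ENNReal.ofReal_mul hM, Real.enorm_eq_ofReal_abs, mul_assoc, ← wStarStar_eq hμ]
            exact ENNReal.ofReal_le_ofReal (hf z hz)
          rw [enorm_mul, ENNReal.ofReal_mul hG]
          refine (mul_le_mul' (enorm_Green_le (by omega) L P y z) hfz).trans (le_of_eq ?_)
          ring
      _ = ENNReal.ofReal (ΓConst N * (F * μ ^ (-τ))) * ∫⁻ z in strip N k L,
            ((∑' i, ENNReal.ofReal (‖z + L • P i - y‖ ^ (-((N : ℝ) - 2)))) *
              ENNReal.ofReal
                (latWeight (τ - 1) (((N : ℝ) - 2) / 2 + τ + 2) μ⁻¹ L P x z)) :=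
          lintegral_const_mul' _ _ ENNReal.ofReal_ne_top
      _ ≤ ENNReal.ofReal (ΓConst N * (F * μ ^ (-τ))) * ENNReal.ofReal
            (C * latWeight (τ - 1) (((N : ℝ) - 2) / 2 + τ) μ⁻¹ L P x y) := by
          gcongr
          exact H _ L x y hε hL hx hy
      _ = ENNReal.ofReal (ΓConst N * C * F * wStar N L P x μ τ y) := by
          rw [← ENNReal.ofReal_mul (by positivity), wStar_eq hμ]
          congr 1
          ring
  rw [Real.enorm_eq_ofReal_abs, ENNReal.ofReal_le_ofReal_iff (by positivity)] at key
  refine key.trans ?_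
  gcongr
  linarith

/-- Membership in the solution space and the norm bound, for a single component. -/
lemma invLap_bounded {N k : ℕ} {P : ℕ → Euc N} (hP : LatticeEnum N k P) (hN : 3 ≤ N)
    (hk1 : 1 ≤ k) (hk2 : (k : ℝ) < ((N : ℝ) - 2) / 2) {τ : ℝ} (hτk : (k : ℝ) < τ)
    (hτN : τ < ((N : ℝ) - 2) / 2) :
    ∃ C : ℝ, 0 < C ∧ ∀ (L μ : ℝ) (x : Euc N), 0 < μ → 1 ≤ L → ‖x‖ ≤ μ⁻¹ →
      ∀ f : Euc N → ℝ, FiniteStarStar N k L P x μ τ f →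
        PeriodicBC N k L (invLap N k L P f) ∧ FiniteStar N k L P x μ τ (invLap N k L P f) ∧
        normStar N k L P x μ τ (invLap N k L P f) ≤ C * normStarStar N k L P x μ τ f := by
  have hkr : (1 : ℝ) ≤ k := by exact_mod_cast hk1
  have hk : k ≤ N := by
    have : (k : ℝ) ≤ N := by linarith
    exact_mod_cast this
  obtain ⟨C, hC, H⟩ := abs_invLap_le hP hN hk1 hk hτk hτN
  refine ⟨C, hC, fun L μ x hμ hL hx f hf => ?_⟩
  have hε : 0 < μ⁻¹ := inv_pos.2 hμ
  have hμτ : 0 < μ ^ (-τ) := Real.rpow_pos_of_pos hμ _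
  have hW : ∀ y ∈ strip N k L, 0 < wStar N L P x μ τ y := fun y hy => by
    rw [wStar_eq hμ]
    exact mul_pos hμτ (latWeight_pos hP hk hε hL hx hy _ (by linarith))
  have hWW : ∀ y ∈ strip N k L, 0 < wStarStar N L P x μ τ y := fun y hy => by
    rw [wStarStar_eq hμ]
    exact mul_pos hμτ (latWeight_pos hP hk hε hL hx hy _ (by linarith))
  set F := normStarStar N k L P x μ τ f with hF
  have hF0 : 0 ≤ F := by
    refine Real.sSup_nonneg ?_
    rintro _ ⟨y, hy, rfl⟩
    exact div_nonneg (abs_nonneg _) (hWW y hy).le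
  have hfF : ∀ z ∈ strip N k L, |f z| ≤ F * wStarStar N L P x μ τ z := fun z hz =>
    (div_le_iff₀ (hWW z hz)).1 (le_csSup hf ⟨z, hz, rfl⟩)
  have hu := H L μ x hμ hL hx f F hF0 hfF
  have hub : ∀ r ∈ (fun y => |invLap N k L P f y| / wStar N L P x μ τ y) '' strip N k L,
      r ≤ C * F := by
    rintro _ ⟨y, hy, rfl⟩
    exact (div_le_iff₀ (hW y hy)).2 (hu y hy)
  refine ⟨⟨fun i hi y _ => invLap_add_period hP L f hi y,
    fun i hi y _ => pd_add_period (invLap_add_period hP L f hi) i y, fun δ hδ => ?_⟩,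
    ⟨C * F, hub⟩, Real.sSup_le hub (by positivity)⟩
  have hM : 0 < C * F * μ ^ (-τ) + 1 := by positivity
  obtain ⟨R, hR⟩ := latWeight_lt_of_tailNorm_large hP hk hε hL hx (τ - 1) hk2
    (t := τ) (by linarith) (div_pos hδ hM)
  refine ⟨R, fun y hy hyR => ?_⟩
  have h1 := hR y hy hyR
  have h2 := latWeight_pos hP hk hε hL hx hy (τ - 1) (q := ((N : ℝ) - 2) / 2 + τ) (by linarith)
  rw [lt_div_iff₀ hM] at h1
  have h3 := hu y hy
  rw [wStar_eq hμ] at h3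
  linarith

/-- Lemma 3.1, `(-Δ)^{-1}` is a bounded linear operator from `Y` to `X`. -/
theorem lemma3_1
    (N k : ℕ) (hN : 5 ≤ N) (hk1 : 1 ≤ k) (hk2 : (k : ℝ) < ((N : ℝ) - 2) / 2)
    (P : ℕ → Euc N) (hP : LatticeEnum N k P)
    (τ : ℝ) (hτk : (k : ℝ) < τ) (hτN : τ < ((N : ℝ) - 2) / 2)
    (θ C0 β : ℝ) (hθ : 0 < θ) (hC0 : 0 < C0)
    (hβ1 : (N : ℝ) - 2 < β) (hβ2 : β < (N : ℝ)) :
    ∃ C : ℝ, 0 < C ∧ ∀ (L : ℝ) (x : Euc N) (μ : ℝ), Admissible N θ C0 β L x μ →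
      ∀ f g : Euc N → ℝ, MemY N k L P x μ τ f g →
        MemX N k L P x μ τ (invLap N k L P f) (invLap N k L P g) ∧
        normStar N k L P x μ τ (invLap N k L P f) +
            normStar N k L P x μ τ (invLap N k L P g) ≤
          C * (normStarStar N k L P x μ τ f + normStarStar N k L P x μ τ g) := by
  obtain ⟨C, hC, H⟩ := invLap_bounded hP (by omega) hk1 hk2 hτk hτN
  refine ⟨C, hC, fun L x μ ⟨hμ, hL, hx, _⟩ f g ⟨hf, hg⟩ => ?_⟩
  have hx' : ‖x‖ ≤ μ⁻¹ := by
    rw [← Real.rpow_neg_one]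
    exact hx.trans (Real.rpow_le_rpow_of_exponent_le hμ (by linarith))
  obtain ⟨hf1, hf2, hf3⟩ := H L μ x (by linarith) hL hx' f hf
  obtain ⟨hg1, hg2, hg3⟩ := H L μ x (by linarith) hL hx' g hg
  exact ⟨⟨hf1, hg1, hf2, hg2⟩, by linarith⟩

end PeriodicCriticalSystem
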